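/- Let ⋆ be a homogeneous preserving semistar operation on R. Then Kr(R,⋆) ⊆ KR(R,⋆), i.e. the usual Kronecker function ring with respect to ⋆ is contained in the homogeneous Kronecker function ring with respect to ⋆, as subsets of the field K(X). -/

import Mathlib

open Pointwise

section
/- `Γ` is a nonzero torsionless (i.e. admitting a compatible total order) cancellative
commutative monoid, `A` is an integral domain graded by `Γ` via `𝒜`, with quotient
field `K`. -/
variable {Γ : Type*} [AddCommMonoid Γ] [LinearOrder Γ]
  [CovariantClass Γ Γ (· + ·) (· < ·)] [Nontrivial Γ]
variable {A : Type*} [CommRing A] [IsDomain A]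
variable {K : Type*} [Field K] [Algebra A K] [IsFractionRing A K]

instance : SMulCommClass K A K := SMulCommClass.symm A K K

variable (𝒜 : Γ → AddSubgroup A) [GradedRing 𝒜]

/-- `a` is a nonzero homogeneous element of the graded domain `A`. -/
def IsHomog (a : A) : Prop := a ≠ 0 ∧ ∃ γ : Γ, a ∈ 𝒜 γ

/-- `x ∈ K` is a (nonzero) homogeneous element of the homogeneous quotient ring `R_H`,
i.e. `x = a/s` with `a` a nonzero homogeneous element and `s ∈ H`. -/
def IsHomogElem (x : K) : Prop :=
  ∃ a s : A, IsHomog 𝒜 a ∧ IsHomog 𝒜 s ∧ x * algebraMap A K s = algebraMap A K a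

/-- `x ∈ K` belongs to the homogeneous quotient ring `R_H`. -/
def MemRH (x : K) : Prop :=
  ∃ a s : A, IsHomog 𝒜 s ∧ x * algebraMap A K s = algebraMap A K a

/-- The image in `K` of an integral ideal of `A`. -/
def idealToK (I : Ideal A) : Submodule A K := Submodule.map (Algebra.linearMap A K) I

/-- `E` is a homogeneous fractional ideal of `A`: `sE` is (the image in `K` of) a
homogeneous integral ideal for some nonzero homogeneous `s`. -/
def IsHomogFrac (E : Submodule A K) : Prop :=
  ∃ s : A, IsHomog 𝒜 s ∧ ∃ I : Ideal A, Ideal.IsHomogeneous 𝒜 I ∧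
    algebraMap A K s • E = idealToK (K := K) I

/-- The four axioms of a semistar operation, imposed on nonzero `A`-submodules of `K`. -/
def IsSemistar (star : Submodule A K → Submodule A K) : Prop :=
  (∀ x : K, x ≠ 0 → ∀ E : Submodule A K, E ≠ ⊥ → star (x • E) = x • star E) ∧
  (∀ E F : Submodule A K, E ≠ ⊥ → E ≤ F → star E ≤ star F) ∧
  (∀ E : Submodule A K, E ≠ ⊥ → E ≤ star E) ∧
  (∀ E : Submodule A K, E ≠ ⊥ → star (star E) = star E)

/-- `star` is homogeneous preserving. -/
def HomogPres (star : Submodule A K → Submodule A K) : Prop :=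
  ∀ E : Submodule A K, E ≠ ⊥ → IsHomogFrac 𝒜 E → IsHomogFrac 𝒜 (star E)

/-- Membership in `E^{⋆_f} = ⋃ {F^⋆ : F nonzero finitely generated, F ⊆ E}`. -/
def MemStarF (star : Submodule A K → Submodule A K) (E : Submodule A K) (x : K) : Prop :=
  ∃ F : Submodule A K, F ≠ ⊥ ∧ F.FG ∧ F ≤ E ∧ x ∈ star F

/-- `star` is of finite type, i.e. `⋆ = ⋆_f`. -/
def IsFiniteType (star : Submodule A K → Submodule A K) : Prop :=
  ∀ E : Submodule A K, E ≠ ⊥ → ∀ x : K, x ∈ star E ↔ MemStarF star E x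

/-- Membership in `E^{⋆_a}`:  `F^{⋆_a} = ⋃ {((FG)^⋆ : G^⋆) : G nonzero f.g.}` for f.g. `F`,
and `E^{⋆_a} = ⋃ {F^{⋆_a} : F ⊆ E nonzero f.g.}`. -/
def MemStarA (star : Submodule A K → Submodule A K) (E : Submodule A K) (x : K) : Prop :=
  ∃ F : Submodule A K, F ≠ ⊥ ∧ F.FG ∧ F ≤ E ∧
    ∃ G : Submodule A K, G ≠ ⊥ ∧ G.FG ∧ ∀ y ∈ star G, x * y ∈ star (F * G)

/-- Membership in `E^{⋆_{a(h)}}`: as in `⋆_a` but with `G` ranging over nonzero finitely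
generated *homogeneous* fractional ideals. -/
def MemStarAH (star : Submodule A K → Submodule A K) (E : Submodule A K) (x : K) : Prop :=
  ∃ F : Submodule A K, F ≠ ⊥ ∧ F.FG ∧ F ≤ E ∧
    ∃ G : Submodule A K, G ≠ ⊥ ∧ G.FG ∧ IsHomogFrac 𝒜 G ∧ ∀ y ∈ star G, x * y ∈ star (F * G)

/-- `star` is graded-e.a.b. -/
def IsGrEab (star : Submodule A K → Submodule A K) : Prop :=
  ∀ E F G : Submodule A K,
    E ≠ ⊥ → E.FG → IsHomogFrac 𝒜 E →
    F ≠ ⊥ → F.FG → IsHomogFrac 𝒜 F →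
    G ≠ ⊥ → G.FG → IsHomogFrac 𝒜 G →
    star (E * F) ≤ star (E * G) → star F ≤ star G

/-- The `A`-submodule of `K` generated by all products `e * v`, `e ∈ E`, `v ∈ S`
(e.g. `EV` for an overring `V`). -/
def mulSet (E : Submodule A K) (S : Set K) : Submodule A K :=
  Submodule.span A {z : K | ∃ e ∈ E, ∃ v ∈ S, z = e * v}

/-- The `b`-operation: `E^b = ⋂ {EV : V a valuation overring of A}`. -/
def bOp : Submodule A K → Submodule A K := fun E =>
  ⨅ (V : ValuationSubring K) (_ : ∀ a : A, algebraMap A K a ∈ V), mulSet E (V : Set K)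

/-- The image of a polynomial over `A` in the rational function field `K(X)`. -/
noncomputable def polyToRatFunc (f : Polynomial A) : RatFunc K :=
  algebraMap (Polynomial K) (RatFunc K) (Polynomial.map (algebraMap A K) f)

/-- The content ideal `c(f)` of a polynomial. -/
def contentIdeal (f : Polynomial A) : Ideal A := Ideal.span (Set.range f.coeff)

/-- The homogeneous content ideal `𝒜_f`, generated by all homogeneous components of all
coefficients of `f`. -/
def homogContentIdeal (f : Polynomial A) : Ideal A :=
  Ideal.span {a : A | ∃ (n : ℕ) (γ : Γ), a = (DirectSum.decompose 𝒜 (f.coeff n) γ : A)}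

/-- The Kronecker function ring `Kr(R,⋆)` as a subset of `K(X)`. -/
def KrSet (star : Submodule A K → Submodule A K) : Set (RatFunc K) :=
  {q | ∃ f g h : Polynomial A, g ≠ 0 ∧ h ≠ 0 ∧
    q * polyToRatFunc (K := K) g = polyToRatFunc (K := K) f ∧
    idealToK (contentIdeal f * contentIdeal h) ≤ star (idealToK (contentIdeal g * contentIdeal h))}

/-- The homogeneous Kronecker function ring `KR(R,⋆)` as a subset of `K(X)`. -/
def KRSet (star : Submodule A K → Submodule A K) : Set (RatFunc K) :=
  {q | ∃ f g h : Polynomial A, g ≠ 0 ∧ h ≠ 0 ∧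
    q * polyToRatFunc (K := K) g = polyToRatFunc (K := K) f ∧
    idealToK (homogContentIdeal 𝒜 f * homogContentIdeal 𝒜 h) ≤
      star (idealToK (homogContentIdeal 𝒜 g * homogContentIdeal 𝒜 h))}

/-- `V` is a homogeneous overring of `A`: `R ⊆ V ⊆ R_H` and `V` is generated as an
additive group by its homogeneous elements. -/
def IsHomogOverring (V : Subring K) : Prop :=
  (∀ a : A, algebraMap A K a ∈ V) ∧ (∀ x ∈ V, MemRH 𝒜 x) ∧
  (∀ v ∈ V, v ∈ AddSubgroup.closure {x : K | x ∈ V ∧ IsHomogElem 𝒜 x})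

/-- `V` is a gr-valuation overring of `A`. -/
def IsGrValOverring (V : Subring K) : Prop :=
  IsHomogOverring 𝒜 V ∧ ∀ x : K, IsHomogElem 𝒜 x → x ∈ V ∨ x⁻¹ ∈ V

/-- `V` is a gr-`⋆`-valuation overring of `A`: `F^⋆ ⊆ FV` for every nonzero finitely
generated homogeneous fractional ideal `F`. -/
def IsGrStarValOverring (star : Submodule A K → Submodule A K) (V : Subring K) : Prop :=
  ∀ F : Submodule A K, F ≠ ⊥ → F.FG → IsHomogFrac 𝒜 F → star F ≤ mulSet F (V : Set K)

end

theorem Ideal.add_pow_succ_le {A : Type*} [CommRing A] (I J : Ideal A) (n : ℕ) :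
    (I + J) ^ (n + 1) ≤ I ^ (n + 1) + J * (I + J) ^ n := by
  induction n with
  | zero => simp
  | succ n ih =>
    calc (I + J) ^ (n + 1 + 1) = I * (I + J) ^ (n + 1) + J * (I + J) ^ (n + 1) := by ring
      _ ≤ I * (I ^ (n + 1) + J * (I + J) ^ n) + J * (I + J) ^ (n + 1) := by gcongr
      _ = I ^ (n + 1 + 1) + J * (I * (I + J) ^ n) + J * (I + J) ^ (n + 1) := by ring
      _ ≤ I ^ (n + 1 + 1) + J * ((I + J) * (I + J) ^ n) + J * (I + J) ^ (n + 1) := by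
        gcongr
        exact le_sup_left
      _ = I ^ (n + 1 + 1) + J * (I + J) ^ (n + 1) := by
        rw [← pow_succ', add_assoc, Submodule.add_eq_sup (J * _), sup_idem]

namespace AddMonoidAlgebra

variable {A Δ : Type*} [CommRing A]

/-- The ideal generated by the coefficients of an element of an additive monoid algebra. -/
def coeffIdeal (x : AddMonoidAlgebra A Δ) : Ideal A := Ideal.span (Set.range x.coeff)

theorem coeff_mem_coeffIdeal (x : AddMonoidAlgebra A Δ) (d : Δ) : x.coeff d ∈ coeffIdeal x :=
  Ideal.subset_span ⟨d, rfl⟩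

theorem coeffIdeal_le_iff {x : AddMonoidAlgebra A Δ} {I : Ideal A} :
    coeffIdeal x ≤ I ↔ ∀ d, x.coeff d ∈ I := by
  rw [coeffIdeal, Ideal.span_le, Set.range_subset_iff]
  rfl

@[simp]
theorem coeffIdeal_zero : coeffIdeal (0 : AddMonoidAlgebra A Δ) = 0 :=
  le_antisymm (coeffIdeal_le_iff.2 fun d => by simp) bot_le

theorem coeffIdeal_add_le (x y : AddMonoidAlgebra A Δ) :
    coeffIdeal (x + y) ≤ coeffIdeal x + coeffIdeal y :=
  coeffIdeal_le_iff.2 fun d => by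
    rw [coeff_add, Finsupp.add_apply]
    exact Submodule.add_mem_sup (coeff_mem_coeffIdeal x d) (coeff_mem_coeffIdeal y d)

theorem coeffIdeal_sub_le (x y : AddMonoidAlgebra A Δ) :
    coeffIdeal (x - y) ≤ coeffIdeal x + coeffIdeal y :=
  coeffIdeal_le_iff.2 fun d => by
    rw [coeff_sub, Finsupp.sub_apply]
    exact Submodule.sub_mem_sup (coeff_mem_coeffIdeal x d) (coeff_mem_coeffIdeal y d)

theorem coeffIdeal_single_le (d : Δ) (a : A) :
    coeffIdeal (single d a) ≤ Ideal.span {a} :=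
  coeffIdeal_le_iff.2 fun e => by
    classical
    rw [coeff_single, Finsupp.single_apply]
    split_ifs
    · exact Ideal.mem_span_singleton_self a
    · exact zero_mem _

theorem coeffIdeal_mul_le [Add Δ] (x y : AddMonoidAlgebra A Δ) :
    coeffIdeal (x * y) ≤ coeffIdeal x * coeffIdeal y :=
  coeffIdeal_le_iff.2 fun d => by
    classical
    rw [coeff_mul, Finsupp.sum]
    refine sum_mem fun i _ => ?_
    rw [Finsupp.sum]
    refine sum_mem fun j _ => ?_
    split_ifs
    · exact Ideal.mul_mem_mul (coeff_mem_coeffIdeal x i) (coeff_mem_coeffIdeal y j)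
    · exact zero_mem _

theorem exists_eq_add_single {x : AddMonoidAlgebra A Δ} {d : Δ} (hd : d ∈ x.coeff.support) :
    ∃ y : AddMonoidAlgebra A Δ, x = y + single d (x.coeff d) ∧
      y.coeff.support.card < x.coeff.support.card ∧ coeffIdeal y ≤ coeffIdeal x := by
  classical
  refine ⟨ofCoeff (x.coeff.erase d), ?_, ?_, ?_⟩
  · apply coeff_injective
    rw [coeff_add, coeff_ofCoeff, coeff_single, Finsupp.erase_add_single]
  · rw [coeff_ofCoeff, Finsupp.support_erase]
    exact Finset.card_erase_lt_of_mem hd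
  · refine coeffIdeal_le_iff.2 fun e => ?_
    rw [coeff_ofCoeff, Finsupp.erase_apply]
    split_ifs
    · exact zero_mem _
    · exact coeff_mem_coeffIdeal x e

/-- The Dedekind–Mertens lemma for monoid algebras over monoids with unique sums. -/
theorem coeffIdeal_pow_succ_mul_le [Add Δ] [UniqueSums Δ] (n : ℕ) (f g : AddMonoidAlgebra A Δ)
    (hg : g.coeff.support.card ≤ n + 1) :
    coeffIdeal f ^ (n + 1) * coeffIdeal g ≤ coeffIdeal f ^ n * coeffIdeal (f * g) := by
  induction n using Nat.strong_induction_on generalizing f g with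
  | _ n ihn =>
  induction hk : f.coeff.support.card using Nat.strong_induction_on generalizing f with
  | _ k ihk =>
  subst hk
  by_cases hf0 : f = 0
  · simp [hf0]
  by_cases hg0 : g = 0
  · simp [hg0]
  obtain ⟨α, hα, β, hβ, huniq⟩ := UniqueSums.uniqueAdd_of_nonempty
    (Finsupp.support_nonempty_iff.2 (mt coeff_eq_zero.1 hf0))
    (Finsupp.support_nonempty_iff.2 (mt coeff_eq_zero.1 hg0))
  have hab : f.coeff α * g.coeff β ∈ coeffIdeal (f * g) :=
    coeff_mul_add_of_uniqueAdd huniq ▸ coeff_mem_coeffIdeal (f * g) (α + β)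
  have ha := coeff_mem_coeffIdeal f α
  obtain ⟨f', hf', hf'card, hf'le⟩ := exists_eq_add_single hα
  obtain ⟨g', hg', hg'card, -⟩ := exists_eq_add_single hβ
  generalize f.coeff α = a at *
  generalize g.coeff β = b at *
  have hFle : coeffIdeal f ≤ coeffIdeal f' + Ideal.span {a} := by
    conv_lhs => rw [hf']
    exact (coeffIdeal_add_le _ _).trans (by gcongr; exact coeffIdeal_single_le _ _)
  have hFeq : coeffIdeal f' + Ideal.span {a} = coeffIdeal f :=
    le_antisymm (sup_le hf'le ((Ideal.span_singleton_le_iff_mem _).2 ha)) hFle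
  have hGle : coeffIdeal g ≤ coeffIdeal g' + Ideal.span {b} := by
    conv_lhs => rw [hg']
    exact (coeffIdeal_add_le _ _).trans (by gcongr; exact coeffIdeal_single_le _ _)
  have hfg' : coeffIdeal (f * g') ≤ coeffIdeal (f * g) + coeffIdeal f * Ideal.span {b} := by
    have h : f * g' = f * g - f * single β b := by
      conv_rhs => rw [hg', mul_add, add_sub_cancel_right]
    rw [h]
    refine (coeffIdeal_sub_le _ _).trans ?_
    gcongr
    exact (coeffIdeal_mul_le _ _).trans (by gcongr; exact coeffIdeal_single_le _ _)
  have hf'g : coeffIdeal (f' * g) ≤ coeffIdeal (f * g) + Ideal.span {a} * coeffIdeal g := by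
    have h : f' * g = f * g - single α a * g := by
      conv_rhs => rw [hf', add_mul, add_sub_cancel_right]
    rw [h]
    refine (coeffIdeal_sub_le _ _).trans ?_
    gcongr
    exact (coeffIdeal_mul_le _ _).trans (by gcongr; exact coeffIdeal_single_le _ _)
  have ihf := ihk _ hf'card f' rfl
  generalize coeffIdeal (f * g) = P at *
  have haF : Ideal.span {a} ≤ coeffIdeal f := (Ideal.span_singleton_le_iff_mem _).2 ha
  have habP : Ideal.span {a} * Ideal.span {b} ≤ P := by
    rw [Ideal.span_singleton_mul_span_singleton]
    exact (Ideal.span_singleton_le_iff_mem _).2 hab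
  have hag' : Ideal.span {a} * coeffIdeal f ^ n * coeffIdeal g' ≤
      coeffIdeal f ^ n * P + coeffIdeal f ^ n * (Ideal.span {a} * Ideal.span {b}) := by
    cases n with
    | zero =>
      have : g' = 0 := by
        rw [← coeff_eq_zero, ← Finsupp.support_eq_empty, ← Finset.card_eq_zero]
        omega
      simp [this]
    | succ m =>
      calc Ideal.span {a} * coeffIdeal f ^ (m + 1) * coeffIdeal g'
          = Ideal.span {a} * (coeffIdeal f ^ (m + 1) * coeffIdeal g') := by ring
        _ ≤ Ideal.span {a} * (coeffIdeal f ^ m * (P + coeffIdeal f * Ideal.span {b})) := by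
          refine Ideal.mul_mono_right ?_
          refine (ihn m (Nat.lt_succ_self m) f g' (by omega)).trans ?_
          gcongr
        _ = Ideal.span {a} * coeffIdeal f ^ m * P +
            coeffIdeal f ^ (m + 1) * (Ideal.span {a} * Ideal.span {b}) := by ring
        _ ≤ coeffIdeal f * coeffIdeal f ^ m * P +
            coeffIdeal f ^ (m + 1) * (Ideal.span {a} * Ideal.span {b}) := by gcongr
        _ = _ := by ring
  have hag : Ideal.span {a} * coeffIdeal f ^ n * coeffIdeal g ≤ coeffIdeal f ^ n * P := by
    calc Ideal.span {a} * coeffIdeal f ^ n * coeffIdeal g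
        ≤ Ideal.span {a} * coeffIdeal f ^ n * (coeffIdeal g' + Ideal.span {b}) := by gcongr
      _ = Ideal.span {a} * coeffIdeal f ^ n * coeffIdeal g' +
          coeffIdeal f ^ n * (Ideal.span {a} * Ideal.span {b}) := by ring
      _ ≤ coeffIdeal f ^ n * P :=
        sup_le (hag'.trans (sup_le le_rfl (by gcongr))) (by gcongr)
  calc coeffIdeal f ^ (n + 1) * coeffIdeal g
      ≤ (coeffIdeal f' ^ (n + 1) + Ideal.span {a} * coeffIdeal f ^ n) * coeffIdeal g := by
        gcongr
        simpa only [hFeq] using Ideal.add_pow_succ_le (coeffIdeal f') (Ideal.span {a}) n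
    _ = coeffIdeal f' ^ (n + 1) * coeffIdeal g +
        Ideal.span {a} * coeffIdeal f ^ n * coeffIdeal g := by ring
    _ ≤ coeffIdeal f ^ n * P := by
      refine sup_le ?_ hag
      calc coeffIdeal f' ^ (n + 1) * coeffIdeal g
          ≤ coeffIdeal f ^ n * (P + Ideal.span {a} * coeffIdeal g) := by
            refine ihf.trans ?_
            gcongr
        _ = coeffIdeal f ^ n * P + Ideal.span {a} * coeffIdeal f ^ n * coeffIdeal g := by ring
        _ ≤ coeffIdeal f ^ n * P := sup_le le_rfl hag

end AddMonoidAlgebra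

section GradedContent

open AddMonoidAlgebra DirectSum

variable {Γ : Type*} [AddCommMonoid Γ] [LinearOrder Γ] {A : Type*} [CommRing A]
variable (𝒜 : Γ → AddSubgroup A) [GradedRing 𝒜]

/-- The ring homomorphism sending a polynomial with coefficients in a graded ring to the element
of the monoid algebra of `ℕ × Γ` that records the homogeneous components of its coefficients. -/
noncomputable def polyToAddMonoidAlgebra : Polynomial A →+* AddMonoidAlgebra A (ℕ × Γ) :=
  Polynomial.eval₂RingHom
    ((DirectSum.toSemiring (fun γ => (AddMonoidAlgebra.singleAddHom ((0, γ) : ℕ × Γ)).comp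
        (𝒜 γ).subtype) (by simp [AddMonoidAlgebra.one_def, Prod.mk_zero_zero]) (fun a b => by
          simp [AddMonoidAlgebra.single_mul_single])).comp
      (DirectSum.decomposeRingEquiv 𝒜).toRingHom)
    (AddMonoidAlgebra.single (1, 0) 1)

theorem polyToAddMonoidAlgebra_monomial {γ : Γ} (n : ℕ) (a : 𝒜 γ) :
    polyToAddMonoidAlgebra 𝒜 (Polynomial.monomial n (a : A)) =
      AddMonoidAlgebra.single (n, γ) (a : A) := by
  simp only [polyToAddMonoidAlgebra, Polynomial.coe_eval₂RingHom, Polynomial.eval₂_monomial,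
    RingHom.comp_apply]
  change DirectSum.toSemiring _ _ _ (DirectSum.decompose 𝒜 (a : A)) * _ = _
  rw [DirectSum.decompose_coe, DirectSum.toSemiring_of]
  simp [AddMonoidAlgebra.single_pow, AddMonoidAlgebra.single_mul_single]

theorem coeff_polyToAddMonoidAlgebra (f : Polynomial A) (n : ℕ) (γ : Γ) :
    (polyToAddMonoidAlgebra 𝒜 f).coeff (n, γ) = (decompose 𝒜 (f.coeff n) γ : A) := by
  induction f using Polynomial.induction_on' with
  | add p q hp hq => simp [hp, hq]
  | monomial m a =>
    induction a using DirectSum.Decomposition.inductionOn 𝒜 with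
    | zero => simp
    | add p q hp hq => simp_all
    | @homogeneous δ a =>
      rw [polyToAddMonoidAlgebra_monomial, Polynomial.coeff_monomial, AddMonoidAlgebra.coeff_single,
        Finsupp.single_apply]
      by_cases hm : m = n
      · by_cases hδ : δ = γ
        · subst hm hδ
          simp
        · rw [if_neg (by simp [hδ]), if_pos hm, DirectSum.decompose_of_mem_ne 𝒜 a.2 hδ]
      · simp [hm]

theorem coeffIdeal_polyToAddMonoidAlgebra (f : Polynomial A) :
    coeffIdeal (polyToAddMonoidAlgebra 𝒜 f) = homogContentIdeal 𝒜 f := by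
  rw [coeffIdeal, homogContentIdeal]
  congr 1
  ext a
  simp [coeff_polyToAddMonoidAlgebra, eq_comm]

theorem exists_homogContentIdeal_pow_succ_mul_le [CovariantClass Γ Γ (· + ·) (· < ·)]
    (f g : Polynomial A) :
    ∃ n : ℕ, homogContentIdeal 𝒜 f ^ (n + 1) * homogContentIdeal 𝒜 g ≤
      homogContentIdeal 𝒜 f ^ n * homogContentIdeal 𝒜 (f * g) := by
  have : IsRightCancelAdd Γ :=
    ⟨fun c a b h => (StrictMono.injective fun _ _ h => CovariantClass.elim c h)
      (by simpa only [add_comm _ c] using h)⟩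
  refine ⟨(polyToAddMonoidAlgebra 𝒜 g).coeff.support.card, ?_⟩
  simp only [← coeffIdeal_polyToAddMonoidAlgebra, map_mul]
  exact coeffIdeal_pow_succ_mul_le _ _ _ (Nat.le_succ _)

theorem coeff_mem_homogContentIdeal (f : Polynomial A) (n : ℕ) :
    f.coeff n ∈ homogContentIdeal 𝒜 f := by
  classical
  rw [← DirectSum.sum_support_decompose 𝒜 (f.coeff n)]
  exact sum_mem fun γ _ => Ideal.subset_span ⟨n, γ, rfl⟩

theorem contentIdeal_le_homogContentIdeal [IsDomain A] (f : Polynomial A) :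
    contentIdeal f ≤ homogContentIdeal 𝒜 f :=
  Ideal.span_le.2 (Set.range_subset_iff.2 (coeff_mem_homogContentIdeal 𝒜 f))

theorem homogContentIdeal_ne_bot {f : Polynomial A} (hf : f ≠ 0) : homogContentIdeal 𝒜 f ≠ ⊥ := by
  refine fun h => hf (Polynomial.ext fun n => ?_)
  simpa [h] using coeff_mem_homogContentIdeal 𝒜 f n

theorem isHomogeneous_homogContentIdeal (f : Polynomial A) :
    (homogContentIdeal 𝒜 f).IsHomogeneous 𝒜 :=
  Ideal.homogeneous_span _ _ (by rintro _ ⟨n, γ, rfl⟩; exact ⟨γ, SetLike.coe_mem _⟩)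

theorem isHomogeneous_homogContentIdeal_pow (f : Polynomial A) (n : ℕ) :
    (homogContentIdeal 𝒜 f ^ n).IsHomogeneous 𝒜 := by
  induction n with
  | zero =>
    rw [pow_zero, Ideal.one_eq_top]
    exact Ideal.IsHomogeneous.top 𝒜
  | succ n ih =>
    rw [pow_succ]
    exact ih.mul (isHomogeneous_homogContentIdeal 𝒜 f)

theorem homogContentIdeal_fg (f : Polynomial A) : (homogContentIdeal 𝒜 f).FG := by
  classical
  rw [← coeffIdeal_polyToAddMonoidAlgebra]
  exact Submodule.fg_span (Finsupp.finite_range _)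

/-- Every finitely generated homogeneous ideal is the homogeneous content of a polynomial. -/
theorem exists_homogContentIdeal_eq {I : Ideal A} (hI : I.FG) (hh : I.IsHomogeneous 𝒜) :
    ∃ p : Polynomial A, homogContentIdeal 𝒜 p = I := by
  obtain ⟨n, s, rfl⟩ := Submodule.fg_iff_exists_fin_generating_family.1 hI
  have hcoeff (i : ℕ) : (∑ j : Fin n, Polynomial.monomial (j : ℕ) (s j)).coeff i =
      if h : i < n then s ⟨i, h⟩ else 0 := by
    rw [Polynomial.finsetSum_coeff]
    split_ifs with h
    · rw [Finset.sum_eq_single ⟨i, h⟩] <;> simp +contextual [Polynomial.coeff_monomial, Fin.ext_iff]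
    · refine Finset.sum_eq_zero fun j _ => ?_
      rw [Polynomial.coeff_monomial, if_neg]
      omega
  refine ⟨∑ j : Fin n, Polynomial.monomial (j : ℕ) (s j), le_antisymm ?_ ?_⟩
  · refine Ideal.span_le.2 ?_
    rintro _ ⟨i, γ, rfl⟩
    apply hh
    rw [hcoeff]
    split_ifs
    · exact Submodule.subset_span ⟨_, rfl⟩
    · exact zero_mem _
  · refine Submodule.span_le.2 ?_
    rintro _ ⟨j, rfl⟩
    simpa [hcoeff] using
      coeff_mem_homogContentIdeal 𝒜 (∑ j : Fin n, Polynomial.monomial (j : ℕ) (s j)) j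

theorem contentIdeal_ne_bot [IsDomain A] {f : Polynomial A} (hf : f ≠ 0) :
    contentIdeal f ≠ ⊥ := by
  refine fun h => hf (Polynomial.ext fun n => ?_)
  have hn : f.coeff n ∈ contentIdeal f := Ideal.subset_span ⟨n, rfl⟩
  simpa [h] using hn

theorem coeff_mul_mem_contentIdeal_mul [IsDomain A] (f g : Polynomial A) (n : ℕ) :
    (f * g).coeff n ∈ contentIdeal f * contentIdeal g := by
  rw [Polynomial.coeff_mul]
  exact sum_mem fun i _ => Ideal.mul_mem_mul (Ideal.subset_span ⟨_, rfl⟩)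
    (Ideal.subset_span ⟨_, rfl⟩)

end GradedContent

section FractionField

variable {A : Type*} [CommRing A] {K : Type*} [Field K] [Algebra A K]

theorem algebraMap_mem_idealToK [IsFractionRing A K] {I : Ideal A} {a : A} :
    algebraMap A K a ∈ idealToK (K := K) I ↔ a ∈ I :=
  ⟨fun ⟨_, hb, hab⟩ => IsFractionRing.injective A K hab ▸ hb, fun h => ⟨a, h, rfl⟩⟩

theorem idealToK_mono {I J : Ideal A} (h : I ≤ J) : idealToK (K := K) I ≤ idealToK J :=
  Submodule.map_mono h

theorem idealToK_ne_bot [IsFractionRing A K] {I : Ideal A} (h : I ≠ ⊥) : idealToK (K := K) I ≠ ⊥ := by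
  obtain ⟨a, ha, ha0⟩ := Submodule.exists_mem_ne_zero_of_ne_bot h
  refine (Submodule.ne_bot_iff _).2 ⟨algebraMap A K a, algebraMap_mem_idealToK.2 ha, ?_⟩
  simpa using ha0

theorem idealToK_le_iff {I : Ideal A} {E : Submodule A K} :
    idealToK I ≤ E ↔ ∀ a ∈ I, algebraMap A K a ∈ E := by
  rw [idealToK, Submodule.map_le_iff_le_comap]
  rfl

theorem IsSemistar.idealToK_mul_le [IsFractionRing A K] {star : Submodule A K → Submodule A K}
    (hstar : IsSemistar star) {I J L : Ideal A} (hJ : J ≠ ⊥) (h : idealToK I ≤ star (idealToK J)) :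
    idealToK (L * I) ≤ star (idealToK (L * J)) := by
  obtain ⟨hsmul, hmono, -, -⟩ := hstar
  refine Submodule.map_le_iff_le_comap.2 (Ideal.mul_le.2 fun a ha b hb => ?_)
  by_cases ha0 : a = 0
  · simp [ha0]
  have ha0' : algebraMap A K a ≠ 0 := by simpa using ha0
  have hle : algebraMap A K a • idealToK (K := K) J ≤ idealToK (L * J) := by
    rintro _ ⟨_, ⟨c, hc, rfl⟩, rfl⟩
    exact ⟨a * c, Ideal.mul_mem_mul ha hc, map_mul (algebraMap A K) _ _⟩
  have hne : algebraMap A K a • idealToK (K := K) J ≠ ⊥ := by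
    obtain ⟨c, hc, hc0⟩ := Submodule.exists_mem_ne_zero_of_ne_bot (idealToK_ne_bot (K := K) hJ)
    exact (Submodule.ne_bot_iff _).2
      ⟨_, Submodule.smul_mem_pointwise_smul c (algebraMap A K a) _ hc, mul_ne_zero ha0' hc0⟩
  have hmem := Submodule.smul_mem_pointwise_smul _ (algebraMap A K a) _
    (idealToK_le_iff.1 h b hb)
  rw [← hsmul _ ha0' _ (idealToK_ne_bot hJ)] at hmem
  simpa using hmono _ _ hne hle hmem

variable {Γ : Type*} [AddCommMonoid Γ] [LinearOrder Γ] (𝒜 : Γ → AddSubgroup A) [GradedRing 𝒜]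

theorem isHomogFrac_idealToK [IsDomain A] {I : Ideal A} (hI : I.IsHomogeneous 𝒜) :
    IsHomogFrac 𝒜 (idealToK (K := K) I) :=
  ⟨1, ⟨one_ne_zero, 0, SetLike.GradedOne.one_mem⟩, I, hI, by simp⟩

theorem IsHomogFrac.decompose_mem [IsFractionRing A K] [CovariantClass Γ Γ (· + ·) (· < ·)]
    {E : Submodule A K} (hE : IsHomogFrac 𝒜 E) {a : A}
    (ha : algebraMap A K a ∈ E) (γ : Γ) :
    algebraMap A K (DirectSum.decompose 𝒜 a γ : A) ∈ E := by
  obtain ⟨s, ⟨hs0, δ, hs⟩, I, hI, hEI⟩ := hE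
  have hs0' : algebraMap A K s ≠ 0 := by simpa using hs0
  have hmem (b : A) : algebraMap A K b ∈ E ↔ s * b ∈ I := by
    rw [← algebraMap_mem_idealToK (K := K), ← hEI, map_mul]
    refine ⟨fun h => Submodule.smul_mem_pointwise_smul _ _ _ h, ?_⟩
    rintro ⟨c, hc, hcb⟩
    exact mul_left_cancel₀ hs0' hcb ▸ hc
  rw [hmem] at ha ⊢
  let : AddLeftCancelMonoid Γ :=
    { (inferInstance : AddCommMonoid Γ) with
      add_left_cancel := fun c => StrictMono.injective fun _ _ h => CovariantClass.elim c h }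
  rw [← DirectSum.coe_decompose_mul_add_of_left_mem 𝒜 hs]
  exact hI _ ha

end FractionField

/-- If `⋆` is a homogeneous preserving semistar operation on the graded
domain `R`, then `Kr(R,⋆) ⊆ KR(R,⋆)` inside `K(X)`. -/
theorem kr_subset_KR
    {Γ : Type*} [AddCommMonoid Γ] [LinearOrder Γ]
    [CovariantClass Γ Γ (· + ·) (· < ·)] [Nontrivial Γ]
    {A : Type*} [CommRing A] [IsDomain A]
    {K : Type*} [Field K] [Algebra A K] [IsFractionRing A K]
    (𝒜 : Γ → AddSubgroup A) [GradedRing 𝒜]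
    (star : Submodule A K → Submodule A K)
    (hstar : IsSemistar star) (hhp : HomogPres 𝒜 star) :
    KrSet star ⊆ KRSet 𝒜 star := by
  rintro q ⟨f, g, h, hg, hh, hq, hle⟩
  have hgh : homogContentIdeal 𝒜 g * homogContentIdeal 𝒜 h ≠ ⊥ :=
    mul_ne_zero (homogContentIdeal_ne_bot 𝒜 hg) (homogContentIdeal_ne_bot 𝒜 hh)
  have hcgh : contentIdeal g * contentIdeal h ≠ ⊥ :=
    mul_ne_zero (contentIdeal_ne_bot hg) (contentIdeal_ne_bot hh)
  obtain ⟨n, hn⟩ := exists_homogContentIdeal_pow_succ_mul_le 𝒜 h f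
  obtain ⟨p, hp⟩ := exists_homogContentIdeal_eq 𝒜
    ((homogContentIdeal_fg 𝒜 h).pow (n := n + 1)) (isHomogeneous_homogContentIdeal_pow 𝒜 h (n + 1))
  have hp0 : p ≠ 0 := by
    rintro rfl
    refine pow_ne_zero (n + 1) (homogContentIdeal_ne_bot 𝒜 hh) (hp.symm.trans ?_)
    simp [homogContentIdeal]
  refine ⟨f, g, p, hg, hp0, hq, ?_⟩
  have hfrac : IsHomogFrac 𝒜 (star (idealToK (homogContentIdeal 𝒜 g * homogContentIdeal 𝒜 h))) :=
    hhp _ (idealToK_ne_bot hgh) (isHomogFrac_idealToK 𝒜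
      ((isHomogeneous_homogContentIdeal 𝒜 g).mul (isHomogeneous_homogContentIdeal 𝒜 h)))
  have hle' : idealToK (contentIdeal f * contentIdeal h) ≤
      star (idealToK (homogContentIdeal 𝒜 g * homogContentIdeal 𝒜 h)) :=
    hle.trans (hstar.2.1 _ _ (idealToK_ne_bot hcgh) (idealToK_mono (Ideal.mul_mono
      (contentIdeal_le_homogContentIdeal 𝒜 g) (contentIdeal_le_homogContentIdeal 𝒜 h))))
  have hhf : idealToK (homogContentIdeal 𝒜 (h * f)) ≤
      star (idealToK (homogContentIdeal 𝒜 g * homogContentIdeal 𝒜 h)) := by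
    refine Submodule.map_le_iff_le_comap.2 (Ideal.span_le.2 ?_)
    rintro _ ⟨i, γ, rfl⟩
    refine hfrac.decompose_mem 𝒜 (idealToK_le_iff.1 hle' _ ?_) γ
    rw [mul_comm h f]
    exact coeff_mul_mem_contentIdeal_mul f h i
  calc idealToK (homogContentIdeal 𝒜 f * homogContentIdeal 𝒜 p)
      ≤ idealToK (homogContentIdeal 𝒜 h ^ n * homogContentIdeal 𝒜 (h * f)) := by
        rw [hp, mul_comm]
        exact idealToK_mono hn
    _ ≤ star (idealToK (homogContentIdeal 𝒜 h ^ n *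
          (homogContentIdeal 𝒜 g * homogContentIdeal 𝒜 h))) := hstar.idealToK_mul_le hgh hhf
    _ = star (idealToK (homogContentIdeal 𝒜 g * homogContentIdeal 𝒜 p)) := by
        rw [hp]
        congr 2
        ring
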